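/- Let ω′ and ω be permutations of [n] with Inv(ω′) ⊆ Inv(ω), and let D(ω′,ω) be the collection of all ω-chamber sets X ⊆ [n] that additionally satisfy: if i < j, ω′(i) > ω′(j) and i ∈ X, then j ∈ X. Then D(ω′,ω) is s-pure, and its s-rank equals |Inv(ω)| − |Inv(ω′)| + n + 1 (so its s-rank coincides with its w-rank). -/

import Mathlib

open Finset

/-- max of a finite set of naturals, with the convention `max0 ∅ = 0`. -/
def max0 (A : Finset ℕ) : ℕ := if h : A.Nonempty then A.max' h else 0

/-- min of a finite set of naturals, with the convention `min0 ∅ = 0`. -/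
def min0 (A : Finset ℕ) : ℕ := if h : A.Nonempty then A.min' h else 0

/-- `A < B` : global dominating, i.e. `max A < min B` (with `min ∅ = max ∅ = 0`). -/
def SetLT (A B : Finset ℕ) : Prop := max0 A < min0 B

/-- `A ⋖ B` : global dominating after cancelations, i.e. `(A − B) < (B − A)`. -/
def LessDot (A B : Finset ℕ) : Prop := SetLT (A \ B) (B \ A)

/-- `A ▷ B` (splitting): `A − B ≠ ∅` and `B − A` is a union of nonempty subsets
`B′, B″` with `B′ < (A − B) < B″`. -/
def Splits (A B : Finset ℕ) : Prop :=
  (A \ B).Nonempty ∧ ∃ B' B'' : Finset ℕ, B'.Nonempty ∧ B''.Nonempty ∧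
    B' ∪ B'' = B \ A ∧ SetLT B' (A \ B) ∧ SetLT (A \ B) B''

/-- `A` and `B` are strongly separated. -/
def StronglySep (A B : Finset ℕ) : Prop := LessDot A B ∨ LessDot B A ∨ A = B

/-- `A` and `B` are weakly separated. -/
def WeaklySep (A B : Finset ℕ) : Prop :=
  StronglySep A B ∨ (Splits A B ∧ B.card ≤ A.card) ∨ (Splits B A ∧ A.card ≤ B.card)

/-- a w-collection: members are pairwise weakly separated. -/
def IsWColl (F : Finset (Finset ℕ)) : Prop := ∀ A ∈ F, ∀ B ∈ F, WeaklySep A B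

/-- a maximal w-collection in the domain `D`. -/
def IsMaxWColl (D : Set (Finset ℕ)) (F : Finset (Finset ℕ)) : Prop :=
  ↑F ⊆ D ∧ IsWColl F ∧
    ∀ G : Finset (Finset ℕ), ↑G ⊆ D → IsWColl G → F ⊆ G → F = G

/-- the domain `D` is w-pure: all maximal w-collections in `D` have the same cardinality. -/
def WPure (D : Set (Finset ℕ)) : Prop :=
  ∀ F G : Finset (Finset ℕ), IsMaxWColl D F → IsMaxWColl D G → F.card = G.card

/-- an s-collection: members are pairwise strongly separated. -/
def IsSColl (F : Finset (Finset ℕ)) : Prop := ∀ A ∈ F, ∀ B ∈ F, StronglySep A B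

/-- a maximal s-collection in the domain `D`. -/
def IsMaxSColl (D : Set (Finset ℕ)) (F : Finset (Finset ℕ)) : Prop :=
  ↑F ⊆ D ∧ IsSColl F ∧
    ∀ G : Finset (Finset ℕ), ↑G ⊆ D → IsSColl G → F ⊆ G → F = G

/-- the domain `D` is s-pure: all maximal s-collections in `D` have the same cardinality. -/
def SPure (D : Set (Finset ℕ)) : Prop :=
  ∀ F G : Finset (Finset ℕ), IsMaxSColl D F → IsMaxSColl D G → F.card = G.card

/-- the set of inversions of `ω` (as a map `[n] → [n]`). -/
def InvPairs (n : ℕ) (ω : ℕ → ℕ) : Finset (ℕ × ℕ) :=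
  (Finset.Icc 1 n ×ˢ Finset.Icc 1 n).filter fun p => p.1 < p.2 ∧ ω p.2 < ω p.1

/-- the domain `D(ω′,ω)`: all `ω`-chamber sets `X` such that moreover
`i < j`, `ω′(i) > ω′(j)`, `i ∈ X` imply `j ∈ X`. -/
def ChamberDomain2 (n : ℕ) (ω' ω : ℕ → ℕ) : Set (Finset ℕ) :=
  {X | X ⊆ Finset.Icc 1 n ∧
    (∀ i ∈ Finset.Icc 1 n, ∀ j ∈ Finset.Icc 1 n, i < j → ω i < ω j → j ∈ X → i ∈ X) ∧
    (∀ i ∈ Finset.Icc 1 n, ∀ j ∈ Finset.Icc 1 n, i < j → ω' j < ω' i → i ∈ X → j ∈ X)}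

theorem setLT_iff {n : ℕ} {A B : Finset ℕ} (hB : B ⊆ Icc 1 n) :
    SetLT A B ↔ B.Nonempty ∧ ∀ a ∈ A, ∀ b ∈ B, a < b := by
  unfold SetLT max0 min0
  by_cases hBne : B.Nonempty
  · have hpos := (mem_Icc.1 (hB (B.min'_mem hBne))).1
    by_cases hAne : A.Nonempty
    · simp only [hAne, hBne, dif_pos, true_and]
      exact ⟨fun h a ha b hb => (A.le_max' a ha).trans_lt (h.trans_le (B.min'_le b hb)),
        fun h => h _ (A.max'_mem hAne) _ (B.min'_mem hBne)⟩
    · rw [not_nonempty_iff_eq_empty.1 hAne]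
      simp [hBne]
      intro b hb
      exact (mem_Icc.1 (hB hb)).1
  · simp [hBne]

theorem stronglySep_iff {n : ℕ} {A B : Finset ℕ} (hA : A ⊆ Icc 1 n) (hB : B ⊆ Icc 1 n) :
    StronglySep A B ↔
      (∀ a ∈ A \ B, ∀ b ∈ B \ A, a < b) ∨ (∀ b ∈ B \ A, ∀ a ∈ A \ B, b < a) := by
  unfold StronglySep LessDot
  rw [setLT_iff (sdiff_subset.trans hB), setLT_iff (sdiff_subset.trans hA)]
  constructor
  · rintro (h | h | rfl)
    · exact Or.inl h.2
    · exact Or.inr h.2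
    · simp
  · intro h
    rcases (A \ B).eq_empty_or_nonempty with hAB | hAB
    · rcases (B \ A).eq_empty_or_nonempty with hBA | hBA
      · exact Or.inr (Or.inr ((sdiff_eq_empty_iff_subset.1 hAB).antisymm
          (sdiff_eq_empty_iff_subset.1 hBA)))
      · exact Or.inl ⟨hBA, by simp [hAB]⟩
    · rcases (B \ A).eq_empty_or_nonempty with hBA | hBA
      · exact Or.inr (Or.inl ⟨hAB, by simp [hBA]⟩)
      · exact h.imp (fun h => ⟨hBA, h⟩) (fun h => Or.inl ⟨hAB, h⟩)

theorem StronglySep.symm {A B : Finset ℕ} (h : StronglySep A B) : StronglySep B A := by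
  unfold StronglySep at *
  tauto

theorem IsSColl.insert {F : Finset (Finset ℕ)} (hF : IsSColl F) {X : Finset ℕ}
    (hX : ∀ A ∈ F, StronglySep A X) : IsSColl (insert X F) := by
  intro A hA B hB
  rcases mem_insert.1 hA with rfl | hA' <;> rcases mem_insert.1 hB with rfl | hB'
  · exact Or.inr (Or.inr rfl)
  · exact (hX B hB').symm
  · exact hX A hA'
  · exact hF A hA' B hB'

/-- A member of the domain strongly separated from the whole domain lies in every maximal
s-collection. -/
theorem IsMaxSColl.mem_of_forall_stronglySep {D : Set (Finset ℕ)} {F : Finset (Finset ℕ)}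
    (hF : IsMaxSColl D F) {X : Finset ℕ} (hXD : X ∈ D) (hX : ∀ A ∈ D, StronglySep A X) :
    X ∈ F := by
  rw [hF.2.2 (insert X F) (by simpa [Set.insert_subset_iff] using ⟨hXD, hF.1⟩)
    (hF.2.1.insert fun A hA => hX A (hF.1 hA)) (subset_insert _ _)]
  exact mem_insert_self _ _

/-- The elements of `[n]` on which `ω` takes its `k` smallest values. -/
def initialSegment (n : ℕ) (ω : ℕ → ℕ) (k : ℕ) : Finset ℕ :=
  (Icc 1 n).filter fun i => ω i ≤ k

/-- `a`, `b` are consecutive with respect to `ω`, and are in the opposite order for both `<`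
and `ω'`. -/
def IsRelDescent (n : ℕ) (ω' ω : ℕ → ℕ) (a b : ℕ) : Prop :=
  a ∈ Icc 1 n ∧ b ∈ Icc 1 n ∧ b < a ∧ ω b = ω a + 1 ∧ ω' b < ω' a

theorem initialSegment_mem_domain {n : ℕ} {ω' ω : ℕ → ℕ} (hInv : InvPairs n ω' ⊆ InvPairs n ω)
    (k : ℕ) : initialSegment n ω k ∈ ChamberDomain2 n ω' ω := by
  refine ⟨filter_subset _ _, fun i hi j hj _ hω hjX => ?_, fun i hi j hj hij hω' hiX => ?_⟩
  · simp only [initialSegment, mem_filter] at *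
    exact ⟨hi, by omega⟩
  · have h : (i, j) ∈ InvPairs n ω :=
      hInv (mem_filter.2 ⟨mem_product.2 ⟨hi, hj⟩, hij, hω'⟩)
    simp only [initialSegment, InvPairs, mem_filter] at *
    exact ⟨hj, by omega⟩

theorem stronglySep_initialSegment {n : ℕ} {ω' ω : ℕ → ℕ} {A : Finset ℕ}
    (hA : A ∈ ChamberDomain2 n ω' ω) (k : ℕ) : StronglySep A (initialSegment n ω k) := by
  refine (stronglySep_iff hA.1 (filter_subset _ _)).2 (Or.inl fun a ha b hb => ?_)
  simp only [mem_sdiff, mem_filter, not_and, not_le] at ha hb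
  have haI := hA.1 ha.1
  have hlt := ha.2 haI
  by_contra hab
  have hne : a ≠ b := by rintro rfl; exact hb.2 ha.1
  exact hb.2 (hA.2.1 b hb.1.1 a haI (by omega) (by omega) ha.1)

theorem isRelDescent_of_mem_of_notMem {n : ℕ} {ω' ω : ℕ → ℕ}
    (hω' : Set.InjOn ω' (Set.Icc 1 n)) {X : Finset ℕ} (hX : X ∈ ChamberDomain2 n ω' ω) {a b : ℕ}
    (ha : a ∈ Icc 1 n) (hab : ω b = ω a + 1) (haX : a ∉ X) (hbX : b ∈ X) :
    IsRelDescent n ω' ω a b := by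
  have hb := hX.1 hbX
  have hne : a ≠ b := by rintro rfl; exact haX hbX
  have hba : b < a := by
    by_contra h
    exact haX (hX.2.1 a ha b hb (by omega) (by omega) hbX)
  refine ⟨ha, hb, hba, hab, ?_⟩
  have hne' : ω' a ≠ ω' b := fun h => hne (hω' (by simpa using ha) (by simpa using hb) h)
  by_contra h
  exact haX (hX.2.2 b hb a ha hba (by omega) hbX)

theorem eq_initialSegment_or_exists_isRelDescent {n : ℕ} {ω' ω : ℕ → ℕ}
    (hω' : Set.InjOn ω' (Set.Icc 1 n)) (hω : Set.BijOn ω (Set.Icc 1 n) (Set.Icc 1 n))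
    {X : Finset ℕ} (hX : X ∈ ChamberDomain2 n ω' ω) :
    (∃ k ≤ n, X = initialSegment n ω k) ∨ ∃ a b, IsRelDescent n ω' ω a b ∧ a ∉ X ∧ b ∈ X := by
  by_contra! hcon
  obtain ⟨hne, hdesc⟩ := hcon
  have hmem : ∀ i, i ∈ Icc 1 n ↔ i ∈ Set.Icc 1 n := by simp
  have hdown : ∀ d i j, i ∈ Icc 1 n → j ∈ X → ω j = ω i + d → i ∈ X := by
    intro d
    induction d with
    | zero =>
      intro i j hi hj h
      rwa [hω.injOn ((hmem i).1 hi) ((hmem j).1 (hX.1 hj)) h.symm]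
    | succ d ih =>
      intro i j hi hj h
      have h1 := hω.mapsTo ((hmem i).1 hi)
      have h2 := hω.mapsTo ((hmem j).1 (hX.1 hj))
      obtain ⟨l, hl, hle⟩ := hω.surjOn (show ω i + d ∈ Set.Icc 1 n by
        simp only [Set.mem_Icc] at *; omega)
      refine ih i l hi ?_ hle
      by_contra hlX
      exact hdesc l j (isRelDescent_of_mem_of_notMem hω' hX ((hmem l).2 hl) (by omega) hlX hj)
        hlX hj
  refine hne (X.sup ω) (Finset.sup_le fun i hi => (hω.mapsTo ((hmem i).1 (hX.1 hi))).2) ?_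
  ext i
  simp only [initialSegment, mem_filter]
  refine ⟨fun hi => ⟨hX.1 hi, Finset.le_sup hi⟩, fun ⟨hi, hle⟩ => ?_⟩
  rcases X.eq_empty_or_nonempty with rfl | hXne
  · have := (hω.mapsTo ((hmem i).1 hi)).1
    simp at hle
    omega
  · obtain ⟨j, hj, hjs⟩ := exists_mem_eq_sup X hXne ω
    exact hdown (ω j - ω i) i j hi hj (by omega)

theorem exists_isRelDescent {n : ℕ} {ω' ω : ℕ → ℕ}
    (hω' : Set.InjOn ω' (Set.Icc 1 n)) (hω : Set.BijOn ω (Set.Icc 1 n) (Set.Icc 1 n))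
    (hInv : InvPairs n ω' ⊆ InvPairs n ω) (hne : ¬ InvPairs n ω ⊆ InvPairs n ω') :
    ∃ a b, IsRelDescent n ω' ω a b := by
  by_contra! hcon
  have hmem : ∀ i, i ∈ Icc 1 n ↔ i ∈ Set.Icc 1 n := by simp
  have hmono : ∀ d i j, i ∈ Icc 1 n → j ∈ Icc 1 n → ω j = ω i + d → ω' i ≤ ω' j := by
    intro d
    induction d with
    | zero =>
      intro i j hi hj h
      rw [hω.injOn ((hmem i).1 hi) ((hmem j).1 hj) h.symm]
    | succ d ih =>
      intro i j hi hj h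
      have h1 := hω.mapsTo ((hmem i).1 hi)
      have h2 := hω.mapsTo ((hmem j).1 hj)
      obtain ⟨l, hl, hle⟩ := hω.surjOn (show ω i + d ∈ Set.Icc 1 n by
        simp only [Set.mem_Icc] at *; omega)
      rw [← hmem] at hl
      refine (ih i l hi hl hle).trans ?_
      by_contra hlt
      refine hcon l j ⟨hl, hj, ?_, by omega, by omega⟩
      by_contra hlj
      have hne : l ≠ j := by rintro rfl; omega
      have : (l, j) ∈ InvPairs n ω :=
        hInv (mem_filter.2 ⟨mem_product.2 ⟨hl, hj⟩, by dsimp; omega, by dsimp; omega⟩)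
      have := (mem_filter.1 this).2.2
      dsimp at this
      omega
  refine hne fun ⟨i, j⟩ hp => ?_
  obtain ⟨hI, hij, hlt⟩ := mem_filter.1 hp
  obtain ⟨hi, hj⟩ := mem_product.1 hI
  dsimp at hi hj hij hlt
  have hle := hmono (ω i - ω j) j i hj hi (by omega)
  have hne' : ω' j ≠ ω' i := fun h => by
    have := hω' ((hmem j).1 hj) ((hmem i).1 hi) h
    omega
  exact mem_filter.2 ⟨hI, hij, lt_of_le_of_ne hle hne'⟩

/-- Among the relative descents of an s-collection there is one that separates a single set. -/
theorem exists_isRelDescent_forall_eq_initialSegment {n : ℕ} {ω' ω : ℕ → ℕ}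
    (hω' : Set.InjOn ω' (Set.Icc 1 n)) (hω : Set.BijOn ω (Set.Icc 1 n) (Set.Icc 1 n))
    (hex : ∃ a b, IsRelDescent n ω' ω a b) {F : Finset (Finset ℕ)}
    (hFD : ↑F ⊆ ChamberDomain2 n ω' ω) (hF : IsSColl F) :
    ∃ a b, IsRelDescent n ω' ω a b ∧
      ∀ X ∈ F, a ∈ X → b ∉ X → X = initialSegment n ω (ω a) := by
  classical
  by_contra! hcon
  set S := F.filter fun X => ∀ k, X ≠ initialSegment n ω k
  have hbad : ∀ a b, IsRelDescent n ω' ω a b → ∃ X ∈ S, a ∈ X ∧ b ∉ X := by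
    intro a b hab
    obtain ⟨X, hXF, haX, hbX, hXne⟩ := hcon a b hab
    refine ⟨X, mem_filter.2 ⟨hXF, fun k hk => ?_⟩, haX, hbX⟩
    obtain ⟨ha, hb, -, hωab, -⟩ := hab
    have h1 : ω a ≤ k := by
      rw [hk] at haX
      exact (mem_filter.1 haX).2
    have h2 : ¬ ω b ≤ k := fun h => hbX (hk ▸ mem_filter.2 ⟨hb, h⟩)
    exact hXne (by rw [hk, show k = ω a by omega])
  obtain ⟨a₀, b₀, h₀⟩ := hex
  obtain ⟨X₀, hX₀, -⟩ := hbad a₀ b₀ h₀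
  obtain ⟨X, hXS, hmax⟩ := S.exists_max_image toColex ⟨X₀, hX₀⟩
  obtain ⟨hXF, hXne⟩ := mem_filter.1 hXS
  rcases eq_initialSegment_or_exists_isRelDescent hω' hω (hFD hXF) with
    ⟨k, -, hk⟩ | ⟨a, b, hab, haX, hbX⟩
  · exact hXne k hk
  obtain ⟨Y, hYS, haY, hbY⟩ := hbad a b hab
  have hYF := (mem_filter.1 hYS).1
  have ha : a ∈ Y \ X := mem_sdiff.2 ⟨haY, haX⟩
  have hb : b ∈ X \ Y := mem_sdiff.2 ⟨hbX, hbY⟩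
  have hba := hab.2.2.1
  refine (hmax Y hYS).not_gt (Colex.toColex_lt_toColex_iff_exists_forall_lt.2
    ⟨a, haY, haX, fun c hcX hcY => ?_⟩)
  have hc : c ∈ X \ Y := mem_sdiff.2 ⟨hcX, hcY⟩
  rcases (stronglySep_iff (hFD hXF).1 (hFD hYF).1).1 (hF X hXF Y hYF) with h | h
  · exact h c hc a ha
  · exact absurd (h a ha b hb) (by omega)

section Swap

variable {n : ℕ} {ω' ω : ℕ → ℕ} {a b : ℕ}

theorem bijOn_swap_comp (hω : Set.BijOn ω (Set.Icc 1 n) (Set.Icc 1 n))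
    (hab : IsRelDescent n ω' ω a b) :
    Set.BijOn (Equiv.swap (ω a) (ω b) ∘ ω) (Set.Icc 1 n) (Set.Icc 1 n) := by
  have ha := hω.mapsTo (show a ∈ Set.Icc 1 n by simpa using hab.1)
  have hb := hω.mapsTo (show b ∈ Set.Icc 1 n by simpa using hab.2.1)
  have hmaps : Set.MapsTo (Equiv.swap (ω a) (ω b)) (Set.Icc 1 n) (Set.Icc 1 n) := by
    intro x hx
    rw [Equiv.swap_apply_def]
    split_ifs <;> assumption
  refine Set.BijOn.comp ⟨hmaps, (Equiv.injective _).injOn, fun x hx => ?_⟩ hω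
  exact ⟨_, hmaps hx, Equiv.swap_apply_self _ _ _⟩

theorem swap_comp_lt_iff (hω : Set.InjOn ω (Set.Icc 1 n)) (hab : IsRelDescent n ω' ω a b)
    {i j : ℕ} (hi : i ∈ Icc 1 n) (hj : j ∈ Icc 1 n) :
    (Equiv.swap (ω a) (ω b) ∘ ω) i < (Equiv.swap (ω a) (ω b) ∘ ω) j ↔
      (i = b ∧ j = a) ∨ (ω i < ω j ∧ ¬ (i = a ∧ j = b)) := by
  obtain ⟨ha, hb, hba, hωab, -⟩ := hab
  have key : ∀ x ∈ Icc 1 n, ∀ y ∈ Icc 1 n, ω x = ω y ↔ x = y := fun x hx y hy =>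
    hω.eq_iff (by simpa using hx) (by simpa using hy)
  have h1 := key i hi a ha
  have h2 := key i hi b hb
  have h3 := key j hj a ha
  have h4 := key j hj b hb
  simp only [Function.comp, Equiv.swap_apply_def]
  rw [← h1, ← h2, ← h3, ← h4]
  split_ifs <;> omega

theorem invPairs_swap_comp (hω : Set.InjOn ω (Set.Icc 1 n)) (hab : IsRelDescent n ω' ω a b) :
    InvPairs n (Equiv.swap (ω a) (ω b) ∘ ω) = (InvPairs n ω).erase (b, a) := by
  ext ⟨i, j⟩
  have hba := hab.2.2.1
  simp only [InvPairs, mem_erase, mem_filter, mem_product, ne_eq, Prod.mk.injEq]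
  constructor
  · rintro ⟨⟨hi, hj⟩, hij, h⟩
    rw [swap_comp_lt_iff hω hab hj hi] at h
    exact ⟨by omega, ⟨hi, hj⟩, hij, by omega⟩
  · rintro ⟨hne, ⟨hi, hj⟩, hij, h⟩
    refine ⟨⟨hi, hj⟩, hij, ?_⟩
    rw [swap_comp_lt_iff hω hab hj hi]
    omega

theorem mem_domain_swap_comp_iff (hω : Set.InjOn ω (Set.Icc 1 n))
    (hab : IsRelDescent n ω' ω a b) {X : Finset ℕ} :
    X ∈ ChamberDomain2 n ω' (Equiv.swap (ω a) (ω b) ∘ ω) ↔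
      X ∈ ChamberDomain2 n ω' ω ∧ (a ∈ X → b ∈ X) := by
  have hba := hab.2.2.1
  constructor
  · rintro ⟨hX, h1, h2⟩
    refine ⟨⟨hX, fun i hi j hj hij h => ?_, h2⟩, ?_⟩
    · exact h1 i hi j hj hij ((swap_comp_lt_iff hω hab hi hj).2 (by omega))
    · exact h1 b hab.2.1 a hab.1 hba ((swap_comp_lt_iff hω hab hab.2.1 hab.1).2 (by simp))
  · rintro ⟨⟨hX, h1, h2⟩, himp⟩
    refine ⟨hX, fun i hi j hj hij h => ?_, h2⟩
    rcases (swap_comp_lt_iff hω hab hi hj).1 h with ⟨rfl, rfl⟩ | h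
    · exact himp
    · exact h1 i hi j hj hij h.1

theorem isMaxSColl_erase_initialSegment (hω : Set.InjOn ω (Set.Icc 1 n))
    (hInv : InvPairs n ω' ⊆ InvPairs n ω) (hab : IsRelDescent n ω' ω a b)
    {F : Finset (Finset ℕ)} (hF : IsMaxSColl (ChamberDomain2 n ω' ω) F)
    (hsep : ∀ X ∈ F, a ∈ X → b ∉ X → X = initialSegment n ω (ω a)) :
    IsMaxSColl (ChamberDomain2 n ω' (Equiv.swap (ω a) (ω b) ∘ ω))
      (F.erase (initialSegment n ω (ω a))) := by
  refine ⟨fun X hX => ?_, fun A hA B hB => hF.2.1 A (mem_of_mem_erase hA) B (mem_of_mem_erase hB),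
    fun G hGD hG hFG => ?_⟩
  · obtain ⟨hne, hXF⟩ := mem_erase.1 (mem_coe.1 hX)
    refine (mem_domain_swap_comp_iff hω hab).2 ⟨hF.1 hXF, fun haX => ?_⟩
    by_contra hbX
    exact hne (hsep X hXF haX hbX)
  · have hGD' : ↑G ⊆ ChamberDomain2 n ω' ω := fun X hX =>
      ((mem_domain_swap_comp_iff hω hab).1 (hGD hX)).1
    have hnot : initialSegment n ω (ω a) ∉ G := fun h => by
      have := ((mem_domain_swap_comp_iff hω hab).1 (hGD h)).2 (mem_filter.2 ⟨hab.1, le_rfl⟩)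
      have h1 := (mem_filter.1 this).2
      have h2 := hab.2.2.2.1
      omega
    rw [hF.2.2 (insert (initialSegment n ω (ω a)) G)
      (by simpa [Set.insert_subset_iff] using ⟨initialSegment_mem_domain hInv _, hGD'⟩)
      (hG.insert fun A hA => stronglySep_initialSegment (hGD' hA) _)
      (subset_insert_iff.2 hFG), erase_insert hnot]

end Swap

theorem card_image_initialSegment {n : ℕ} {ω : ℕ → ℕ}
    (hω : Set.BijOn ω (Set.Icc 1 n) (Set.Icc 1 n)) :
    ((range (n + 1)).image (initialSegment n ω)).card = n + 1 := by
  rw [card_image_of_injOn, card_range]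
  have key : ∀ k l, l ≤ n → k < l → initialSegment n ω k ≠ initialSegment n ω l := by
    intro k l hl hkl h
    obtain ⟨i, hi, rfl⟩ := hω.surjOn (show l ∈ Set.Icc 1 n from ⟨by omega, hl⟩)
    have : i ∈ initialSegment n ω k := h ▸ mem_filter.2 ⟨by simpa using hi, le_rfl⟩
    have := (mem_filter.1 this).2
    omega
  intro k hk l hl h
  simp only [coe_range, Set.mem_Iio] at hk hl
  rcases lt_trichotomy k l with hlt | rfl | hlt
  · exact absurd h (key k l (by omega) hlt)
  · rfl
  · exact absurd h.symm (key l k (by omega) hlt)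

theorem IsMaxSColl.card_eq {n : ℕ} {ω' : ℕ → ℕ} (hω' : Set.InjOn ω' (Set.Icc 1 n)) (m : ℕ) :
    ∀ ω : ℕ → ℕ, Set.BijOn ω (Set.Icc 1 n) (Set.Icc 1 n) → InvPairs n ω' ⊆ InvPairs n ω →
      (InvPairs n ω).card = (InvPairs n ω').card + m →
      ∀ F : Finset (Finset ℕ), IsMaxSColl (ChamberDomain2 n ω' ω) F → F.card = m + n + 1 := by
  induction m with
  | zero =>
    intro ω hω hInv hcard F hF
    have hEq : InvPairs n ω' = InvPairs n ω := eq_of_subset_of_card_le hInv hcard.le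
    have hFeq : F = (range (n + 1)).image (initialSegment n ω) := by
      ext X
      simp only [mem_image, mem_range]
      constructor
      · intro hX
        rcases eq_initialSegment_or_exists_isRelDescent hω' hω (hF.1 hX) with
          ⟨k, hk, rfl⟩ | ⟨a, b, ⟨ha, hb, hba, hωab, hω'ab⟩, -⟩
        · exact ⟨k, by omega, rfl⟩
        · have h : (b, a) ∈ InvPairs n ω :=
            mem_filter.2 ⟨mem_product.2 ⟨hb, ha⟩, hba, by dsimp; omega⟩
          rw [← hEq] at h
          exact absurd (mem_filter.1 h).2.2 (by dsimp; omega)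
      · rintro ⟨k, -, rfl⟩
        exact hF.mem_of_forall_stronglySep (initialSegment_mem_domain hInv k)
          fun A hA => stronglySep_initialSegment hA k
    rw [hFeq, card_image_initialSegment hω, Nat.zero_add]
  | succ m ih =>
    intro ω hω hInv hcard F hF
    have hne : ¬ InvPairs n ω ⊆ InvPairs n ω' := fun h => by
      have := card_le_card h
      omega
    obtain ⟨a, b, hab, hsep⟩ := exists_isRelDescent_forall_eq_initialSegment hω' hω
      (exists_isRelDescent hω' hω hInv hne) hF.1 hF.2.1
    obtain ⟨ha, hb, hba, hωab, hω'ab⟩ := id hab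
    have hmem : (b, a) ∈ InvPairs n ω :=
      mem_filter.2 ⟨mem_product.2 ⟨hb, ha⟩, hba, by dsimp; omega⟩
    have hnot : (b, a) ∉ InvPairs n ω' := fun h =>
      absurd (mem_filter.1 h).2.2 (by dsimp; omega)
    have hswap := invPairs_swap_comp hω.injOn hab
    have hcard' := card_erase_add_one hmem
    have hres := ih _ (bijOn_swap_comp hω hab)
      (by rw [hswap]; exact subset_erase.2 ⟨hInv, hnot⟩) (by rw [hswap]; omega) _
      (isMaxSColl_erase_initialSegment hω.injOn hInv hab hF hsep)
    have hXF : initialSegment n ω (ω a) ∈ F :=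
      hF.mem_of_forall_stronglySep (initialSegment_mem_domain hInv _)
        fun A hA => stronglySep_initialSegment hA _
    have := card_erase_add_one hXF
    omega

/-- for permutations `ω′, ω` of `[n]` with `Inv(ω′) ⊆ Inv(ω)`, the
domain `D(ω′,ω)` is s-pure, with s-rank `|Inv(ω)| − |Inv(ω′)| + n + 1`. -/
theorem chamber_domain2_s_pure (n : ℕ) (hn : 1 ≤ n) (ω' ω : ℕ → ℕ)
    (hω' : Set.BijOn ω' (Set.Icc 1 n) (Set.Icc 1 n))
    (hω : Set.BijOn ω (Set.Icc 1 n) (Set.Icc 1 n))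
    (hInv : InvPairs n ω' ⊆ InvPairs n ω) :
    SPure (ChamberDomain2 n ω' ω) ∧
    ∀ F : Finset (Finset ℕ), IsMaxSColl (ChamberDomain2 n ω' ω) F →
      F.card = (InvPairs n ω).card - (InvPairs n ω').card + n + 1 := by
  have key : ∀ F : Finset (Finset ℕ), IsMaxSColl (ChamberDomain2 n ω' ω) F →
      F.card = (InvPairs n ω).card - (InvPairs n ω').card + n + 1 :=
    IsMaxSColl.card_eq hω'.injOn _ ω hω hInv (Nat.add_sub_of_le (card_le_card hInv)).symm
  exact ⟨fun F G hF hG => (key F hF).trans (key G hG).symm, key⟩
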